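/- arXiv:2206.09095 — 2 statements merged into one kernel-verified Lean document; each statement's English description precedes it below -/
import Mathlib

section
/- For every α > γ₀, the initial value problem dW/dr = (g(W) − W)/r for r > 1, W(1) = α, has a unique solution W = W(·, α) ∈ C¹([1, +∞)) taking values in (γ₀, +∞), and lim_{r→∞} W(r, α) = c_*. -/
open Set Filter

/-- The vector `(β, γ, …, γ) ∈ ℝⁿ`: first coordinate `β`, all remaining coordinates `γ`. -/
def vec (n : ℕ) (β γ : ℝ) : Fin n → ℝ := fun j => if (j : ℕ) = 0 then β else γ

/-- `w` is a `C¹` solution on `[1, ∞)` of the ODE `dW/dr = (g(W) - W)/r` with `w 1 = a`,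
taking values in `(γ₀, ∞)`. -/
def IsSolW (g : ℝ → ℝ) (γ₀ a : ℝ) (w : ℝ → ℝ) : Prop :=
  ContDiffOn ℝ 1 w (Set.Ici 1) ∧ w 1 = a ∧ (∀ r ∈ Set.Ici (1 : ℝ), γ₀ < w r) ∧
    ∀ r ∈ Set.Ici (1 : ℝ), HasDerivWithinAt w ((g (w r) - w r) / r) (Set.Ici 1) r

lemma vec_self (n : ℕ) (c : ℝ) : vec n c c = fun _ => c := by
  funext j
  simp [vec]

lemma vec_le_vec {n : ℕ} {β β' γ γ' : ℝ} (hβ : β ≤ β') (hγ : γ ≤ γ') :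
    vec n β γ ≤ vec n β' γ' := by
  intro j
  by_cases hj : (j : ℕ) = 0 <;> simp [vec, hj, hβ, hγ]

lemma vec_injective_left {n : ℕ} (hn : 0 < n) {β β' γ γ' : ℝ}
    (h : vec n β γ = vec n β' γ') : β = β' := by
  simpa [vec] using congrFun h ⟨0, hn⟩

lemma smul_vec_add_smul_vec (n : ℕ) (s t β β' γ γ' : ℝ) :
    s • vec n β γ + t • vec n β' γ' = vec n (s • β + t • β') (s • γ + t • γ') := by
  funext j
  by_cases hj : (j : ℕ) = 0 <;> simp [vec, hj]

/-- On an open convex set, a differentiable function all of whose partial derivatives are positive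
is strictly increasing for the product order. -/
lemma strictMonoOn_of_partialDeriv_pos {ι : Type*} [Fintype ι] [DecidableEq ι]
    {Γ : Set (ι → ℝ)} (hΓopen : IsOpen Γ) (hΓconv : Convex ℝ Γ) {f : (ι → ℝ) → ℝ}
    (hf : DifferentiableOn ℝ f Γ)
    (hpos : ∀ x ∈ Γ, ∀ j : ι, 0 < fderiv ℝ f x (Pi.single j 1)) : StrictMonoOn f Γ := by
  intro x hx y hy hxy
  have hmem : ∀ t ∈ Icc (0 : ℝ) 1, x + t • (y - x) ∈ Γ := fun t ht =>
    hΓconv.add_smul_sub_mem hx hy ht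
  have hderiv : ∀ t ∈ Icc (0 : ℝ) 1, HasDerivAt (fun t : ℝ => f (x + t • (y - x)))
      (fderiv ℝ f (x + t • (y - x)) (y - x)) t := by
    intro t ht
    have h1 : HasDerivAt (fun t : ℝ => x + t • (y - x)) (y - x) t := by
      simpa using ((hasDerivAt_id t).smul_const (y - x)).const_add x
    exact ((hf.differentiableAt (hΓopen.mem_nhds (hmem t ht))).hasFDerivAt).comp_hasDerivAt t h1
  have hderiv_pos : ∀ z ∈ Γ, 0 < fderiv ℝ f z (y - x) := by
    intro z hz
    obtain ⟨hle, j, hj⟩ := Pi.lt_def.1 hxy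
    rw [pi_eq_sum_univ' (y - x), map_sum]
    refine Finset.sum_pos' (fun i _ => ?_) ⟨j, Finset.mem_univ j, ?_⟩
    · rw [map_smul]
      exact mul_nonneg (sub_nonneg.2 (hle i)) (hpos z hz i).le
    · rw [map_smul]
      exact mul_pos (sub_pos.2 hj) (hpos z hz j)
  have hmono : StrictMonoOn (fun t : ℝ => f (x + t • (y - x))) (Icc 0 1) :=
    strictMonoOn_of_hasDerivWithinAt_pos (convex_Icc 0 1)
      (fun t ht => (hderiv t ht).continuousAt.continuousWithinAt)
      (fun t ht => (hderiv t (interior_subset ht)).hasDerivWithinAt)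
      (fun t ht => hderiv_pos _ (hmem t (interior_subset ht)))
  simpa using hmono (left_mem_Icc.2 zero_le_one) (right_mem_Icc.2 zero_le_one) one_pos

section LevelCurve

variable {n : ℕ} {Γ : Set (Fin n → ℝ)} {f : (Fin n → ℝ) → ℝ} {g : ℝ → ℝ} {s : Set ℝ} {c : ℝ}

lemma antitoneOn_levelCurve (hn : 0 < n) (hmono : StrictMonoOn f Γ)
    (hg : ∀ γ ∈ s, vec n (g γ) γ ∈ Γ ∧ f (vec n (g γ) γ) = c) : AntitoneOn g s := by
  intro a ha b hb hab
  by_contra! h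
  have hlt : vec n (g a) a < vec n (g b) b :=
    lt_of_le_of_ne (vec_le_vec h.le hab) fun he => h.ne (vec_injective_left hn he)
  have := hmono (hg a ha).1 (hg b hb).1 hlt
  rw [(hg a ha).2, (hg b hb).2] at this
  exact this.false

lemma convexOn_levelCurve (hn : 0 < n) (hmono : StrictMonoOn f Γ) (hf : ConcaveOn ℝ Γ f)
    (hs : Convex ℝ s)
    (hg : ∀ γ ∈ s, vec n (g γ) γ ∈ Γ ∧ f (vec n (g γ) γ) = c) : ConvexOn ℝ s g := by
  refine ⟨hs, fun a ha b hb p q hp hq hpq => ?_⟩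
  by_contra! h
  have hmem := hf.1 (hg a ha).1 (hg b hb).1 hp hq hpq
  have hle := hf.2 (hg a ha).1 (hg b hb).1 hp hq hpq
  rw [(hg a ha).2, (hg b hb).2, ← add_smul, hpq, one_smul] at hle
  rw [smul_vec_add_smul_vec] at hmem hle
  have hab := hg _ (hs ha hb hp hq hpq)
  have := hmono hmem hab.1
    (lt_of_le_of_ne (vec_le_vec h.le le_rfl) fun he => h.ne (vec_injective_left hn he))
  linarith [hab.2]

end LevelCurve

/-- An antitone convex function is Lipschitz away from the left end of its domain. -/
lemma ConvexOn.lipschitzOnWith_Icc_of_antitoneOn {g : ℝ → ℝ} {c a b : ℝ} (hca : c < a)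
    (hconv : ConvexOn ℝ (Icc c b) g) (hanti : AntitoneOn g (Icc c b)) :
    LipschitzOnWith (Real.toNNReal ((g c - g a) / (a - c))) g (Icc a b) := by
  have key : ∀ x ∈ Icc a b, ∀ y ∈ Icc a b, x < y →
      |g x - g y| ≤ (g c - g a) / (a - c) * |x - y| := by
    intro x hx y hy hxy
    have hcx : c < x := hca.trans_le hx.1
    have hcmem : c ∈ Icc c b := ⟨le_rfl, (hcx.trans hxy).le.trans hy.2⟩
    have hamem : a ∈ Icc c b := ⟨hca.le, hx.1.trans hx.2⟩
    have hxmem : x ∈ Icc c b := ⟨hcx.le, hx.2⟩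
    have hymem : y ∈ Icc c b := ⟨(hcx.trans hxy).le, hy.2⟩
    have h1 := hconv.slope_mono_adjacent hcmem hymem hcx hxy
    have h2 : (g a - g c) / (a - c) ≤ (g x - g c) / (x - c) :=
      hconv.secant_mono hcmem hamem hxmem hca.ne' hcx.ne' hx.1
    have h3 := h2.trans h1
    rw [le_div_iff₀ (sub_pos.2 hxy)] at h3
    rw [abs_of_nonneg (sub_nonneg.2 (hanti hxmem hymem hxy.le)), abs_of_neg (sub_neg.2 hxy),
      ← neg_sub (g a), neg_div]
    linarith
  refine LipschitzOnWith.of_dist_le_mul fun x hx y hy => ?_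
  rw [Real.dist_eq, Real.dist_eq]
  refine le_trans ?_ (mul_le_mul_of_nonneg_right (Real.le_coe_toNNReal _) (abs_nonneg _))
  rcases lt_trichotomy x y with h | rfl | h
  · exact key x hx y hy h
  · simp
  · rw [abs_sub_comm, abs_sub_comm x]
    exact key y hy x hx h

section ODE

variable {G : ℝ → ℝ}

/-- Two solutions of `dW/dr = (G(W) - W)/r` with `G` antitone approach each other at least like
`1/r`. -/
lemma antitoneOn_sq_mul_sub {S D : Set ℝ} (hG : AntitoneOn G S) (hD : Convex ℝ D)
    (hDpos : D ⊆ Ioi 0) {u v : ℝ → ℝ}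
    (hu : ∀ r ∈ D, HasDerivWithinAt u ((G (u r) - u r) / r) D r) (huS : ∀ r ∈ D, u r ∈ S)
    (hv : ∀ r ∈ D, HasDerivWithinAt v ((G (v r) - v r) / r) D r) (hvS : ∀ r ∈ D, v r ∈ S) :
    AntitoneOn (fun r => (r * (u r - v r)) ^ 2) D := by
  have hderiv : ∀ r ∈ D, HasDerivWithinAt (fun r => (r * (u r - v r)) ^ 2)
      (2 * r * ((u r - v r) * (G (u r) - G (v r)))) D r := by
    intro r hr
    have hr0 : r ≠ 0 := (hDpos hr).ne'
    refine (((hasDerivWithinAt_id r D).mul ((hu r hr).sub (hv r hr))).pow 2).congr_deriv ?_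
    simp only [id, Pi.sub_apply, Pi.mul_apply, Nat.cast_ofNat, Nat.add_one_sub_one, pow_one]
    field_simp
    ring
  refine antitoneOn_of_hasDerivWithinAt_nonpos hD (fun r hr => (hderiv r hr).continuousWithinAt)
    (fun r hr => (hderiv r (interior_subset hr)).mono interior_subset) fun r hr => ?_
  have hrD := interior_subset hr
  have hr0 : 0 < r := hDpos hrD
  refine mul_nonpos_of_nonneg_of_nonpos (by positivity) ?_
  rcases le_total (u r) (v r) with h | h
  · exact mul_nonpos_of_nonpos_of_nonneg (sub_nonpos.2 h)
      (sub_nonneg.2 (hG (huS r hrD) (hvS r hrD) h))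
  · exact mul_nonpos_of_nonneg_of_nonpos (sub_nonneg.2 h)
      (sub_nonpos.2 (hG (hvS r hrD) (huS r hrD) h))

lemma eq_of_eq_of_antitoneOn {S D : Set ℝ} (hG : AntitoneOn G S) (hD : Convex ℝ D)
    (hDpos : D ⊆ Ioi 0) {u v : ℝ → ℝ}
    (hu : ∀ r ∈ D, HasDerivWithinAt u ((G (u r) - u r) / r) D r) (huS : ∀ r ∈ D, u r ∈ S)
    (hv : ∀ r ∈ D, HasDerivWithinAt v ((G (v r) - v r) / r) D r) (hvS : ∀ r ∈ D, v r ∈ S)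
    {r₀ r : ℝ} (hr₀ : r₀ ∈ D) (hr : r ∈ D) (hle : r₀ ≤ r) (heq : u r₀ = v r₀) : u r = v r := by
  have h := antitoneOn_sq_mul_sub hG hD hDpos hu huS hv hvS hr₀ hr hle
  have hr0 : 0 < r := hDpos hr
  simp only [heq, sub_self, mul_zero, ne_eq, OfNat.ofNat_ne_zero, not_false_eq_true,
    zero_pow] at h
  have h2 := pow_eq_zero_iff two_ne_zero |>.1 (h.antisymm (sq_nonneg _))
  exact sub_eq_zero.1 ((mul_eq_zero.1 h2).resolve_left hr0.ne')

/-- Solutions of `dW/dr = (G(W) - W)/r` exist on every interval `[1, T]` when `G` is bounded and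
Lipschitz. -/
lemma exists_solution_Icc {K M : NNReal} (hG : LipschitzWith K G) (hM : ∀ x, |G x| ≤ M)
    (α : ℝ) {T : ℝ} (hT : 1 ≤ T) :
    ∃ w : ℝ → ℝ, w 1 = α ∧
      ∀ r ∈ Icc 1 T, HasDerivWithinAt w ((G (w r) - w r) / r) (Icc 1 T) r := by
  have hPL : IsPicardLindelof (fun r x => G (x / r)) (tmin := 1) (tmax := T)
      ⟨1, left_mem_Icc.2 hT⟩ α (M * (T - 1).toNNReal) 0 M K := by
    refine ⟨fun r hr => ?_, fun x _ r hr => ?_, fun r _ x _ => hM _, ?_⟩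
    · refine LipschitzOnWith.of_dist_le_mul fun x _ y _ => (hG.dist_le_mul _ _).trans ?_
      have hr0 : 0 < r := one_pos.trans_le hr.1
      refine mul_le_mul_of_nonneg_left ?_ K.2
      rw [Real.dist_eq, Real.dist_eq, ← sub_div, abs_div, abs_of_pos hr0]
      exact div_le_self (abs_nonneg _) hr.1
    · have hr0 : r ≠ 0 := (one_pos.trans_le hr.1).ne'
      exact (hG.continuous.continuousAt.comp
        (continuousAt_const.div continuousAt_id hr0)).continuousWithinAt
    · simp [hT]
  obtain ⟨u, hu1, hu⟩ := hPL.exists_eq_forall_mem_Icc_hasDerivWithinAt₀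
  refine ⟨fun r => u r / r, by simpa using hu1, fun r hr => ?_⟩
  have hr0 : r ≠ 0 := (one_pos.trans_le hr.1).ne'
  refine ((hu r hr).div (hasDerivWithinAt_id r _) hr0).congr_deriv ?_
  simp only [id]
  field_simp

lemma exists_solution_Ici {K M : NNReal} (hG : LipschitzWith K G) (hanti : Antitone G)
    (hM : ∀ x, |G x| ≤ M) (α : ℝ) :
    ∃ w : ℝ → ℝ, w 1 = α ∧
      ∀ r ∈ Ici (1 : ℝ), HasDerivWithinAt w ((G (w r) - w r) / r) (Ici 1) r := by
  choose W hW1 hW using fun N : ℕ =>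
    exists_solution_Icc hG hM α (T := N + 1) (by linarith [N.cast_nonneg (α := ℝ)])
  have hcompat : ∀ N N' : ℕ, ∀ r : ℝ, 1 ≤ r → r ≤ N + 1 → r ≤ N' + 1 → W N r = W N' r := by
    intro N N' r h1 hN hN'
    exact eq_of_eq_of_antitoneOn (hanti.antitoneOn univ) (convex_Icc 1 r)
      (fun x hx => one_pos.trans_le hx.1)
      (fun x hx => (hW N x ⟨hx.1, hx.2.trans hN⟩).mono (Icc_subset_Icc_right hN))
      (fun _ _ => mem_univ _)
      (fun x hx => (hW N' x ⟨hx.1, hx.2.trans hN'⟩).mono (Icc_subset_Icc_right hN'))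
      (fun _ _ => mem_univ _) (left_mem_Icc.2 h1) (right_mem_Icc.2 h1) h1
      ((hW1 N).trans (hW1 N').symm)
  refine ⟨fun r => W ⌈r⌉₊ r, hW1 _, fun r hr => ?_⟩
  have heq : ∀ x ∈ Icc (1 : ℝ) (⌈r⌉₊ + 1), W ⌈x⌉₊ x = W ⌈r⌉₊ x := fun x hx =>
    hcompat _ _ x hx.1 ((Nat.le_ceil x).trans (by linarith)) hx.2
  have hlt : r < ⌈r⌉₊ + 1 := (Nat.le_ceil r).trans_lt (lt_add_one _)
  have h := (hW ⌈r⌉₊ r ⟨hr, hlt.le⟩).congr heq rfl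
  refine h.mono_of_mem_nhdsWithin ?_
  rw [← Ici_inter_Iic]
  exact inter_mem_nhdsWithin _ (Iic_mem_nhds hlt)

end ODE

section ConstantSolution

variable {g : ℝ → ℝ} {c : ℝ}

lemma hasDerivWithinAt_const_of_isFixedPt (hc : g c = c) (D : Set ℝ) (r : ℝ) :
    HasDerivWithinAt (fun _ : ℝ => c) ((g c - c) / r) D r := by
  simpa [hc] using hasDerivWithinAt_const r D c

lemma Ici_one_subset_Ioi_zero : Ici (1 : ℝ) ⊆ Ioi 0 := Ici_subset_Ioi.2 one_pos

lemma mul_abs_sub_le_of_antitoneOn {S : Set ℝ} (hanti : AntitoneOn g S) (hc : g c = c)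
    (hcS : c ∈ S) {w : ℝ → ℝ}
    (hw : ∀ r ∈ Ici (1 : ℝ), HasDerivWithinAt w ((g (w r) - w r) / r) (Ici 1) r)
    (hwS : ∀ r ∈ Ici (1 : ℝ), w r ∈ S) {r : ℝ} (hr : 1 ≤ r) :
    r * |w r - c| ≤ |w 1 - c| := by
  have hsq := antitoneOn_sq_mul_sub hanti (convex_Ici 1) Ici_one_subset_Ioi_zero hw hwS
    (fun r _ => hasDerivWithinAt_const_of_isFixedPt hc _ r) (fun _ _ => hcS) self_mem_Ici hr hr
  have habs := sq_le_sq.1 hsq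
  rwa [abs_mul, abs_of_pos (one_pos.trans_le hr), one_mul] at habs

/-- A solution stays between its initial value and the equilibrium. -/
lemma mem_uIcc_of_antitoneOn {S : Set ℝ} (hanti : AntitoneOn g S) (hc : g c = c) (hcS : c ∈ S)
    {w : ℝ → ℝ} (hw : ∀ r ∈ Ici (1 : ℝ), HasDerivWithinAt w ((g (w r) - w r) / r) (Ici 1) r)
    (hwS : ∀ r ∈ Ici (1 : ℝ), w r ∈ S) {r : ℝ} (hr : 1 ≤ r) : w r ∈ uIcc (w 1) c := by
  have habs : |w r - c| ≤ |w 1 - c| :=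
    (le_mul_of_one_le_left (abs_nonneg _) hr).trans
      (mul_abs_sub_le_of_antitoneOn hanti hc hcS hw hwS hr)
  by_contra hmem
  have hcmem : c ∈ uIcc (w 1) (w r) := by
    rw [mem_uIcc] at hmem ⊢
    grind
  obtain ⟨r₀, hr₀, hwr₀⟩ := intermediate_value_uIcc (f := w) (a := 1) (b := r)
    (fun x hx => ((hw x (by rw [uIcc_of_le hr] at hx; exact hx.1)).continuousWithinAt.mono
      (by rw [uIcc_of_le hr]; exact Icc_subset_Ici_self))) hcmem
  rw [uIcc_of_le hr] at hr₀
  have := eq_of_eq_of_antitoneOn hanti (convex_Ici 1) Ici_one_subset_Ioi_zero hw hwS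
    (fun r _ => hasDerivWithinAt_const_of_isFixedPt hc _ r) (fun _ _ => hcS) hr₀.1 hr hr₀.2 hwr₀
  exact hmem (this ▸ right_mem_uIcc)

/-- Solutions converge to the equilibrium. -/
lemma tendsto_of_antitoneOn {S : Set ℝ} (hanti : AntitoneOn g S) (hc : g c = c) (hcS : c ∈ S)
    {w : ℝ → ℝ} (hw : ∀ r ∈ Ici (1 : ℝ), HasDerivWithinAt w ((g (w r) - w r) / r) (Ici 1) r)
    (hwS : ∀ r ∈ Ici (1 : ℝ), w r ∈ S) : Tendsto w atTop (nhds c) := by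
  refine tendsto_iff_dist_tendsto_zero.2 ?_
  refine squeeze_zero' (Eventually.of_forall fun _ => dist_nonneg) ?_
    (tendsto_const_nhds.div_atTop tendsto_id : Tendsto (fun r : ℝ => |w 1 - c| / r) atTop _)
  filter_upwards [eventually_ge_atTop 1] with r hr
  rw [Real.dist_eq, le_div_iff₀' (one_pos.trans_le hr)]
  exact mul_abs_sub_le_of_antitoneOn hanti hc hcS hw hwS hr

end ConstantSolution

lemma exists_isSolW {g : ℝ → ℝ} {γ₀ c α : ℝ} (hconv : ConvexOn ℝ (Ioi γ₀) g)
    (hanti : AntitoneOn g (Ioi γ₀)) (hc : g c = c) (hcγ : γ₀ < c) (hα : γ₀ < α) :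
    ∃ w, IsSolW g γ₀ α w := by
  obtain ⟨d, hd, hda⟩ := exists_between (lt_min hα hcγ)
  set a := min α c
  set b := max α c
  have hab : a ≤ b := min_le_max
  have hsub : Icc d b ⊆ Ioi γ₀ := fun x hx => hd.trans_le hx.1
  have hsub' : Icc a b ⊆ Ioi γ₀ := (Icc_subset_Icc_left hda.le).trans hsub
  have hlip := (hconv.subset hsub (convex_Icc d b)).lipschitzOnWith_Icc_of_antitoneOn hda
    (hanti.mono hsub)
  set G : ℝ → ℝ := IccExtend hab ((Icc a b).domRestrict g)
  have hGg : ∀ x ∈ Icc a b, G x = g x := fun x hx => IccExtend_of_mem hab _ hx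
  have hGlip := (lipschitzOnWith_iff_restrict.1 hlip).comp (LipschitzWith.projIcc hab)
  have hGanti : Antitone G := fun x y hxy =>
    hanti (hsub' (projIcc a b hab x).2) (hsub' (projIcc a b hab y).2) (monotone_projIcc hab hxy)
  have hGbdd : ∀ x, |G x| ≤ (max |g a| |g b|).toNNReal := fun x => by
    have hx := (projIcc a b hab x).2
    refine le_trans ?_ (Real.le_coe_toNNReal _)
    rw [max_comm]
    exact abs_le_max_abs_abs (hanti (hsub' hx) (hsub' (right_mem_Icc.2 hab)) hx.2)
      (hanti (hsub' (left_mem_Icc.2 hab)) (hsub' hx) hx.1)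
  obtain ⟨w, hw1, hw⟩ := exists_solution_Ici hGlip hGanti hGbdd α
  change ∀ r ∈ Ici (1 : ℝ), HasDerivWithinAt w ((G (w r) - w r) / r) (Ici 1) r at hw
  have hmem : ∀ r ∈ Ici (1 : ℝ), w r ∈ Icc a b := fun r hr => by
    have := mem_uIcc_of_antitoneOn (hGanti.antitoneOn univ)
      ((hGg c ⟨min_le_right _ _, le_max_right _ _⟩).trans hc) (mem_univ c) hw
      (fun _ _ => mem_univ _) hr
    rwa [hw1] at this
  have hcont : ContinuousOn w (Ici 1) := fun r hr => (hw r hr).continuousWithinAt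
  refine ⟨w, ?_, hw1, fun r hr => hsub' (hmem r hr), fun r hr => ?_⟩
  · refine (contDiffOn_one_iff_derivWithin (uniqueDiffOn_Ici 1)).2
      ⟨fun r hr => (hw r hr).differentiableWithinAt, ?_⟩
    refine ContinuousOn.congr (f := fun r => (G (w r) - w r) / r) ?_
      fun r hr => (hw r hr).derivWithin (uniqueDiffOn_Ici 1 r hr)
    exact ((hGlip.continuous.comp_continuousOn hcont).sub hcont).div continuousOn_id
      fun r hr => (Ici_one_subset_Ioi_zero hr).ne'
  · rw [← hGg _ (hmem r hr)]
    exact hw r hr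

/-- For every `α > γ₀`, the initial value problem `dW/dr = (g(W) − W)/r`, `W(1) = α`
has a unique `C¹` solution on `[1, ∞)` with values in `(γ₀, ∞)`, and
`W(r, α) → c_*` as `r → ∞`. -/
theorem stmt9 (n : ℕ) (hn : 2 ≤ n)
    (Γ : Set (Fin n → ℝ))
    (hΓopen : IsOpen Γ)
    (hΓconv : Convex ℝ Γ)
    (hΓcone : ∀ x ∈ Γ, ∀ t : ℝ, 0 < t → t • x ∈ Γ)
    (hΓsym : ∀ σ : Equiv.Perm (Fin n), ∀ x ∈ Γ, (x ∘ σ) ∈ Γ)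
    (hΓ1 : {x : Fin n → ℝ | ∀ j, 0 < x j} ⊆ Γ)
    (hΓ2 : Γ ⊆ {x : Fin n → ℝ | 0 < ∑ j, x j})
    (f : (Fin n → ℝ) → ℝ)
    (hfsmooth : ContDiffOn ℝ (⊤ : ℕ∞) f Γ)
    (hfcont : ContinuousOn f (closure Γ))
    (hfsym : ∀ σ : Equiv.Perm (Fin n), ∀ x : Fin n → ℝ, f (x ∘ σ) = f x)
    (hfconc : ConcaveOn ℝ Γ f)
    (hfpos : ∀ x ∈ Γ, 0 < f x)
    (hfbd : ∀ x ∈ frontier Γ, f x = 0)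
    (hfmono : ∀ x ∈ Γ, ∀ j : Fin n, 0 < fderiv ℝ f x (Pi.single j 1))
    (cstar : ℝ) (hcstar : 0 < cstar)
    (hfcstar : f (fun _ => cstar) = 1)
    (γ₀ : ℝ)
    (hγ₀ : γ₀ = sInf {γ : ℝ | 0 < γ ∧ ∃ β : ℝ, vec n β γ ∈ Γ ∧ f (vec n β γ) = 1})
    (hγ₀0 : 0 ≤ γ₀) (hγ₀cstar : γ₀ < cstar)
    (g : ℝ → ℝ)
    (hg : ∀ γ ∈ Set.Ioi γ₀, vec n (g γ) γ ∈ Γ ∧ f (vec n (g γ) γ) = 1)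
    (hgu : ∀ γ ∈ Set.Ioi γ₀, ∀ β : ℝ, vec n β γ ∈ Γ → f (vec n β γ) = 1 → β = g γ) :
    ∀ α ∈ Set.Ioi γ₀, ∃ w : ℝ → ℝ, IsSolW g γ₀ α w ∧
      (∀ w' : ℝ → ℝ, IsSolW g γ₀ α w' → Set.EqOn w' w (Set.Ici 1)) ∧
      Tendsto w atTop (nhds cstar) := by
  have hn0 : 0 < n := by omega
  have hmono : StrictMonoOn f Γ := strictMonoOn_of_partialDeriv_pos hΓopen hΓconv
    (hfsmooth.differentiableOn (by simp)) hfmono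
  have hanti : AntitoneOn g (Ioi γ₀) := antitoneOn_levelCurve hn0 hmono hg
  have hconv : ConvexOn ℝ (Ioi γ₀) g :=
    convexOn_levelCurve hn0 hmono hfconc (convex_Ioi γ₀) hg
  have hfix : g cstar = cstar := by
    refine (hgu cstar hγ₀cstar cstar ?_ ?_).symm
    · rw [vec_self]
      exact hΓ1 fun _ => hcstar
    · rw [vec_self, hfcstar]
  intro α hα
  obtain ⟨w, hw⟩ := exists_isSolW hconv hanti hfix hγ₀cstar hα
  refine ⟨w, hw, fun w' hw' r hr => ?_,
    tendsto_of_antitoneOn hanti hfix hγ₀cstar hw.2.2.2 hw.2.2.1⟩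
  exact eq_of_eq_of_antitoneOn hanti (convex_Ici 1) Ici_one_subset_Ioi_zero
    hw'.2.2.2 hw'.2.2.1 hw.2.2.2 hw.2.2.1 self_mem_Ici hr hr (hw'.2.1.trans hw.2.1.symm)
end

section
/- For all α₂ > α₁ > c_* and all r ≥ 1, W(r, α₂) − W(r, α₁) ≥ (α₂ − α₁) r^{−n}. Consequently, for each fixed r ≥ 1, W(r, α) → +∞ as α → +∞. -/
open Set Filter

theorem lt_of_fderiv_single_pos {n : ℕ} {Γ : Set (Fin n → ℝ)} (hΓopen : IsOpen Γ)
    (hΓconv : Convex ℝ Γ) {f : (Fin n → ℝ) → ℝ} (hf : DifferentiableOn ℝ f Γ)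
    (hfmono : ∀ x ∈ Γ, ∀ j : Fin n, 0 < fderiv ℝ f x (Pi.single j 1))
    {x y : Fin n → ℝ} (hx : x ∈ Γ) (hy : y ∈ Γ) (hxy : x < y) : f x < f y := by
  have hmem : ∀ t ∈ Icc (0 : ℝ) 1, AffineMap.lineMap x y t ∈ Γ := fun t ht =>
    hΓconv.lineMap_mem hx hy ht
  have hder : ∀ t ∈ Icc (0 : ℝ) 1, HasDerivAt (fun s : ℝ => f (AffineMap.lineMap x y s))
      (fderiv ℝ f (AffineMap.lineMap x y t) (y - x)) t := fun t ht =>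
    (((hf _ (hmem t ht)).differentiableAt (hΓopen.mem_nhds (hmem t ht))).hasFDerivAt).comp_hasDerivAt
      t AffineMap.hasDerivAt_lineMap
  have hmono : StrictMonoOn (fun s : ℝ => f (AffineMap.lineMap x y s)) (Icc 0 1) := by
    refine strictMonoOn_of_deriv_pos (convex_Icc 0 1)
      (fun t ht => (hder t ht).continuousAt.continuousWithinAt) fun t ht => ?_
    have ht' := interior_subset ht
    rw [(hder t ht').deriv, (pi_eq_sum_univ' (y - x) :), map_sum]
    obtain ⟨hle, j, hj⟩ := Pi.lt_def.1 hxy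
    have hterm : ∀ i, fderiv ℝ f (AffineMap.lineMap x y t) ((y - x) i • Pi.single i 1) =
        (y i - x i) * fderiv ℝ f (AffineMap.lineMap x y t) (Pi.single i 1) := fun i => by
      rw [map_smul, smul_eq_mul, Pi.sub_apply]
    refine Finset.sum_pos' (fun i _ => ?_) ⟨j, Finset.mem_univ j, ?_⟩
    · simpa only [hterm] using
        mul_nonneg (sub_nonneg.2 (hle i)) (hfmono _ (hmem t ht') i).le
    · simpa only [hterm] using mul_pos (sub_pos.2 hj) (hfmono _ (hmem t ht') j)
  simpa using hmono (left_mem_Icc.2 zero_le_one) (right_mem_Icc.2 zero_le_one) zero_lt_one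

theorem ConcaveOn.le_map_mean_of_symmetric {n : ℕ} [NeZero n] {Γ : Set (Fin n → ℝ)}
    (hΓsym : ∀ σ : Equiv.Perm (Fin n), ∀ x ∈ Γ, (x ∘ σ) ∈ Γ) {f : (Fin n → ℝ) → ℝ}
    (hfsym : ∀ σ : Equiv.Perm (Fin n), ∀ x : Fin n → ℝ, f (x ∘ σ) = f x)
    (hfconc : ConcaveOn ℝ Γ f) {x : Fin n → ℝ} (hx : x ∈ Γ) :
    (fun _ => (∑ j, x j) / n) ∈ Γ ∧ f x ≤ f (fun _ => (∑ j, x j) / n) := by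
  have hn : (n : ℝ) ≠ 0 := Nat.cast_ne_zero.2 (NeZero.ne n)
  have hw : ∑ _j : Fin n, (n : ℝ)⁻¹ = 1 := by simp [hn]
  have hmean : ∑ j : Fin n, (n : ℝ)⁻¹ • (x ∘ Equiv.addRight j) = fun _ => (∑ j, x j) / n := by
    funext i
    have h := Equiv.sum_comp (Equiv.addLeft i) x
    simp only [Equiv.coe_addLeft] at h
    simp only [Finset.sum_apply, Pi.smul_apply, Function.comp_apply, Equiv.coe_addRight,
      smul_eq_mul, ← Finset.mul_sum, h]
    ring
  rw [← hmean]
  refine ⟨hfconc.1.sum_mem (fun _ _ => by positivity) hw fun j _ => hΓsym _ x hx, ?_⟩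
  have h := hfconc.le_map_sum (t := Finset.univ) (w := fun _ => (n : ℝ)⁻¹)
    (p := fun j : Fin n => x ∘ Equiv.addRight j) (fun _ _ => by positivity) hw
    fun j _ => hΓsym _ x hx
  simpa only [hfsym, ← Finset.sum_smul, hw, one_smul] using h

theorem sum_vec {n : ℕ} [NeZero n] (β γ : ℝ) : ∑ j, vec n β γ j = β + (n - 1) * γ := by
  obtain ⟨m, rfl⟩ := Nat.exists_eq_succ_of_ne_zero (NeZero.ne n)
  simp [Fin.sum_univ_succ, vec]

theorem div_pow_le_sub_of_hasDerivWithinAt {n : ℕ} {g : ℝ → ℝ} {c : ℝ}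
    (hg : ∀ x y, c ≤ x → x < y → -(n - 1) * (y - x) ≤ g y - g x) {u v : ℝ → ℝ}
    (hu : ∀ r ∈ Ici (1 : ℝ), HasDerivWithinAt u ((g (u r) - u r) / r) (Ici 1) r)
    (hv : ∀ r ∈ Ici (1 : ℝ), HasDerivWithinAt v ((g (v r) - v r) / r) (Ici 1) r)
    (hcv : ∀ r ∈ Ici (1 : ℝ), c ≤ v r) (h1 : v 1 < u 1) {r : ℝ} (hr : 1 ≤ r) :
    (u 1 - v 1) / r ^ n ≤ u r - v r := by
  set a := u 1 - v 1 with ha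
  have hder : ∀ x ∈ Ici (1 : ℝ), HasDerivWithinAt (fun x => x ^ n * (u x - v x))
      (n * x ^ (n - 1) * (u x - v x) +
        x ^ n * ((g (u x) - u x) / x - (g (v x) - v x) / x)) (Ici 1) x := fun x hx =>
    ((hasDerivAt_pow n x).hasDerivWithinAt).mul ((hu x hx).sub (hv x hx))
  have key : ∀ ε : ℝ, 0 < ε → ε * (r - 1) < a → a - ε * (r - 1) ≤ r ^ n * (u r - v r) := by
    intro ε hε hεa
    have hline : ∀ x : ℝ, HasDerivAt (fun x : ℝ => a - ε * (x - 1)) (-ε) x := fun x => by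
      simpa using (((hasDerivAt_id x).sub_const 1).const_mul ε).const_sub a
    refine image_le_of_deriv_right_lt_deriv_boundary' (a := 1) (b := r)
      (f := fun x => a - ε * (x - 1)) (f' := fun _ => -ε)
      (fun x _ => (hline x).continuousAt.continuousWithinAt)
      (fun x _ => (hline x).hasDerivWithinAt) (by simp [ha])
      (fun x hx => ((hder x hx.1).continuousWithinAt).mono Icc_subset_Ici_self)
      (fun x hx => (hder x hx.1).mono (Ici_subset_Ici.2 hx.1)) ?_ (right_mem_Icc.2 hr)
    rintro x ⟨hx1, hxr⟩ heq
    have hx0 : 0 < x := zero_lt_one.trans_le hx1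
    have hpos : 0 < x ^ n * (u x - v x) := by
      rw [← heq]
      nlinarith
    have huv : v x < u x := sub_pos.1 (pos_of_mul_pos_right hpos (by positivity))
    have hgx := hg _ _ (hcv x hx1) huv
    have hpow : (n : ℝ) * x ^ (n - 1) = n * x ^ n / x := by
      rcases n with _ | m
      · simp
      · rw [Nat.add_sub_cancel, pow_succ]
        field_simp
    have hrw : (n : ℝ) * x ^ (n - 1) * (u x - v x) +
        x ^ n * ((g (u x) - u x) / x - (g (v x) - v x) / x) =
        x ^ n / x * (g (u x) - g (v x) + (n - 1) * (u x - v x)) := by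
      rw [hpow]
      ring
    rw [hrw]
    have : 0 ≤ x ^ n / x * (g (u x) - g (v x) + (n - 1) * (u x - v x)) :=
      mul_nonneg (by positivity) (by linarith)
    linarith
  rw [div_le_iff₀ (by positivity), mul_comm (u r - v r)]
  refine le_of_forall_pos_sub_le fun δ hδ => ?_
  have ha0 : 0 < a := sub_pos.2 h1
  have hm : 0 < min δ (a / 2) := lt_min hδ (by linarith)
  have hle : min δ (a / 2) / r * (r - 1) ≤ min δ (a / 2) := by
    rw [div_mul_eq_mul_div, div_le_iff₀ (by linarith)]
    nlinarith
  have h := key (min δ (a / 2) / r) (by positivity)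
    (hle.trans_lt ((min_le_right _ _).trans_lt (by linarith)))
  linarith [min_le_left δ (a / 2)]

/-- For `α₂ > α₁ > c_*` and `r ≥ 1`, `W(r, α₂) − W(r, α₁) ≥ (α₂ − α₁) r^{−n}`;
consequently for each fixed `r ≥ 1`, `W(r, α) → +∞` as `α → +∞`. -/
theorem stmt12 (n : ℕ) (hn : 2 ≤ n)
    (Γ : Set (Fin n → ℝ))
    (hΓopen : IsOpen Γ)
    (hΓconv : Convex ℝ Γ)
    (hΓcone : ∀ x ∈ Γ, ∀ t : ℝ, 0 < t → t • x ∈ Γ)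
    (hΓsym : ∀ σ : Equiv.Perm (Fin n), ∀ x ∈ Γ, (x ∘ σ) ∈ Γ)
    (hΓ1 : {x : Fin n → ℝ | ∀ j, 0 < x j} ⊆ Γ)
    (hΓ2 : Γ ⊆ {x : Fin n → ℝ | 0 < ∑ j, x j})
    (f : (Fin n → ℝ) → ℝ)
    (hfsmooth : ContDiffOn ℝ (⊤ : ℕ∞) f Γ)
    (hfcont : ContinuousOn f (closure Γ))
    (hfsym : ∀ σ : Equiv.Perm (Fin n), ∀ x : Fin n → ℝ, f (x ∘ σ) = f x)
    (hfconc : ConcaveOn ℝ Γ f)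
    (hfpos : ∀ x ∈ Γ, 0 < f x)
    (hfbd : ∀ x ∈ frontier Γ, f x = 0)
    (hfmono : ∀ x ∈ Γ, ∀ j : Fin n, 0 < fderiv ℝ f x (Pi.single j 1))
    (cstar : ℝ) (hcstar : 0 < cstar)
    (hfcstar : f (fun _ => cstar) = 1)
    (γ₀ : ℝ)
    (hγ₀ : γ₀ = sInf {γ : ℝ | 0 < γ ∧ ∃ β : ℝ, vec n β γ ∈ Γ ∧ f (vec n β γ) = 1})
    (hγ₀0 : 0 ≤ γ₀) (hγ₀cstar : γ₀ < cstar)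
    (g : ℝ → ℝ)
    (hg : ∀ γ ∈ Set.Ioi γ₀, vec n (g γ) γ ∈ Γ ∧ f (vec n (g γ) γ) = 1)
    (hgu : ∀ γ ∈ Set.Ioi γ₀, ∀ β : ℝ, vec n β γ ∈ Γ → f (vec n β γ) = 1 → β = g γ)
    (W : ℝ → ℝ → ℝ)
    (hW : ∀ α ∈ Set.Ioi γ₀, IsSolW g γ₀ α (W α)) :
    (∀ α₁ α₂ : ℝ, cstar < α₁ → α₁ < α₂ → ∀ r ∈ Set.Ici (1 : ℝ),
        (α₂ - α₁) / r ^ n ≤ W α₂ r - W α₁ r) ∧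
    ∀ r ∈ Set.Ici (1 : ℝ), Tendsto (fun α : ℝ => W α r) atTop atTop := by
  have : NeZero n := ⟨by omega⟩
  have hn0 : (0 : ℝ) < n := by positivity
  have hlt : ∀ {x y : Fin n → ℝ}, x ∈ Γ → y ∈ Γ → x < y → f x < f y :=
    lt_of_fderiv_single_pos hΓopen hΓconv (hfsmooth.differentiableOn (by simp)) hfmono
  have hvec : ∀ c : ℝ, vec n c c = fun _ => c := fun c => by
    funext j
    simp [vec]
  have hcΓ : (fun _ => cstar) ∈ Γ := hΓ1 fun _ => hcstar
  have hgc : g cstar = cstar :=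
    (hgu cstar hγ₀cstar cstar (by rwa [hvec]) (by rwa [hvec])).symm
  have hconv : ConvexOn ℝ (Ioi γ₀) g := by
    refine ⟨convex_Ioi γ₀, fun x hx y hy a b ha hb hab => ?_⟩
    obtain ⟨hxΓ, hfx⟩ := hg x hx
    obtain ⟨hyΓ, hfy⟩ := hg y hy
    obtain ⟨hzΓ, hfz⟩ := hg _ (convex_Ioi γ₀ hx hy ha hb hab)
    have hcomb : a • vec n (g x) x + b • vec n (g y) y =
        vec n (a • g x + b • g y) (a • x + b • y) := by
      funext j
      by_cases hj : (j : ℕ) = 0 <;> simp [vec, hj]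
    have hΓ' := hΓconv hxΓ hyΓ ha hb hab
    have hf' := hfconc.2 hxΓ hyΓ ha hb hab
    rw [hcomb] at hΓ' hf'
    rw [hfx, hfy, smul_eq_mul, smul_eq_mul, mul_one, mul_one, hab] at hf'
    by_contra! hcon
    refine (hlt hΓ' hzΓ (Pi.lt_def.2 ⟨fun j => ?_, 0, ?_⟩)).not_ge (hfz.trans_le hf')
    · by_cases hj : (j : ℕ) = 0
      · simpa [vec, hj] using hcon.le
      · simp [vec, hj]
    · simpa [vec] using hcon
  have hmean : ∀ x ∈ Ioi γ₀, n * cstar ≤ g x + (n - 1) * x := by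
    intro x hx
    obtain ⟨hxΓ, hfx⟩ := hg x hx
    obtain ⟨hmΓ, hfm⟩ := hfconc.le_map_mean_of_symmetric hΓsym hfsym hxΓ
    rw [sum_vec] at hmΓ hfm
    rw [hfx] at hfm
    by_contra! hcon
    have hlt' : (g x + (n - 1) * x) / n < cstar := by
      rw [div_lt_iff₀ hn0]
      linarith
    exact (hlt hmΓ hcΓ (Pi.lt_def.2 ⟨fun _ => hlt'.le, 0, hlt'⟩)).not_ge (hfcstar.trans_le hfm)
  have hslope : ∀ x y, cstar ≤ x → x < y → -(n - 1) * (y - x) ≤ g y - g x := by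
    intro x y hx hxy
    rcases hx.eq_or_lt with rfl | hx
    · linarith [hmean y (hγ₀cstar.trans hxy)]
    · have h := hconv.slope_mono_adjacent hγ₀cstar (hγ₀cstar.trans (hx.trans hxy)) hx hxy
      have hm := hmean x (hγ₀cstar.trans hx)
      have h' : -((n : ℝ) - 1) ≤ (g x - g cstar) / (x - cstar) := by
        rw [le_div_iff₀ (sub_pos.2 hx)]
        linarith
      exact (le_div_iff₀ (sub_pos.2 hxy)).1 (h'.trans h)
  have hconst : ∀ r ∈ Ici (1 : ℝ),
      HasDerivWithinAt (fun _ : ℝ => cstar) ((g cstar - cstar) / r) (Ici 1) r := fun r _ => by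
    simpa [hgc] using hasDerivWithinAt_const r (Ici (1 : ℝ)) cstar
  have hge : ∀ α, cstar < α → ∀ r ∈ Ici (1 : ℝ), cstar ≤ W α r := by
    intro α hα r hr
    obtain ⟨-, hW1, -, hder⟩ := hW α (hγ₀cstar.trans hα)
    have h := div_pow_le_sub_of_hasDerivWithinAt hslope hder hconst (fun _ _ => le_rfl)
      (by rwa [hW1]) hr
    have hr0 : 0 < r := zero_lt_one.trans_le hr
    have : 0 ≤ (W α 1 - cstar) / r ^ n :=
      div_nonneg (by rw [hW1]; linarith) (by positivity)
    linarith
  have hmain : ∀ α₁ α₂ : ℝ, cstar < α₁ → α₁ < α₂ → ∀ r ∈ Ici (1 : ℝ),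
      (α₂ - α₁) / r ^ n ≤ W α₂ r - W α₁ r := by
    intro α₁ α₂ h₁ h₂ r hr
    obtain ⟨-, hW1, -, hder₁⟩ := hW α₁ (hγ₀cstar.trans h₁)
    obtain ⟨-, hW2, -, hder₂⟩ := hW α₂ (hγ₀cstar.trans (h₁.trans h₂))
    have h := div_pow_le_sub_of_hasDerivWithinAt hslope hder₂ hder₁ (hge α₁ h₁)
      (by rwa [hW1, hW2]) hr
    rwa [hW1, hW2] at h
  refine ⟨hmain, fun r hr => ?_⟩
  have hr0 : 0 < r := zero_lt_one.trans_le hr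
  have hlin : Tendsto (fun α : ℝ => W (cstar + 1) r + (α - (cstar + 1)) / r ^ n) atTop atTop :=
    tendsto_atTop_add_const_left _ _
      ((tendsto_atTop_add_const_right _ _ tendsto_id).atTop_div_const (by positivity))
  refine tendsto_atTop_mono' _ ?_ hlin
  filter_upwards [eventually_gt_atTop (cstar + 1)] with α hα
  linarith [hmain (cstar + 1) α (by linarith) hα r hr]
end
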